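/- arXiv:1909.09918 — 5 statements merged into one kernel-verified Lean document; each statement's English description precedes it below -/
import Mathlib

section
/- Fix an integer d ≥ 1 and define p^{(d)}_{k,l} for integers k ≥ 0, l ≥ 0 by p^{(d)}_{k,0} = 1 and p^{(d)}_{k,l} = (1/4) Σ_{s=0}^{k-2} (s+1)(s+1+d) p^{(d)}_{s,l-1} for l ≥ 1 (an empty sum for k ≤ 1). Then: (i) the coefficients of the 1/M̃² moment expansion factorise as μ^{(d)}_{k,l} = μ^{(d)}_{k,0} p^{(d)}_{k,l}; and (ii) for each l ≥ 0 there is a polynomial P_l ∈ ℝ[X] of degree 3l such that p^{(d)}_{k,l} = P_l(k) for all integers k ≥ 0. -/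
open MeasureTheory Real

/-- Physicists' Hermite polynomials: `H 0 = 1`, `H 1 x = 2x`,
`H (n+2) x = 2x H (n+1) x - 2(n+1) H n x`. -/
noncomputable def hermiteH : ℕ → ℝ → ℝ
  | 0 => fun _ => 1
  | 1 => fun x => 2 * x
  | (n + 2) => fun x => 2 * x * hermiteH (n + 1) x - 2 * (n + 1) * hermiteH n x

/-- Normalised harmonic oscillator eigenfunctions. -/
noncomputable def ψho (l : ℕ) (x : ℝ) : ℝ :=
  (Real.sqrt (2 ^ l * (Nat.factorial l) * Real.sqrt π))⁻¹ * hermiteH l x * Real.exp (-x ^ 2 / 2)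

/-- Ground-state density of the `d`-dimensional harmonically trapped Fermi gas,
shell label `M`: sum over occupation arrays `l ∈ ℕ^d` with `l 1 + ⋯ + l d ≤ M`. -/
noncomputable def fermiDensity (d M : ℕ) (x : EuclideanSpace ℝ (Fin d)) : ℝ :=
  ∑ l ∈ Finset.filter (fun l => ∑ j, l j ≤ M)
      (Fintype.piFinset fun _ : Fin d => Finset.range (M + 1)),
    ∏ j, (ψho (l j) (x j)) ^ 2

/-- Generalised Laguerre polynomial `L_n^{(α)}` with natural parameter `α`. -/
noncomputable def laguerreL (n α : ℕ) (x : ℝ) : ℝ :=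
  ∑ k ∈ Finset.range (n + 1),
    (-1 : ℝ) ^ k * (Nat.choose (n + α) (n - k) : ℝ) * x ^ k / (Nat.factorial k : ℝ)

open Polynomial in
theorem exists_prim_mono (n : ℕ) : ∃ T : Polynomial ℝ, T.natDegree ≤ n + 1 ∧ T.coeff (n + 1) ≠ 0 ∧
    ∀ x : ℝ, T.eval (1 + x) = T.eval x + x ^ n := by
  have hn : ((n : ℝ) + 1) ≠ 0 := by positivity
  refine ⟨C (((n : ℝ) + 1)⁻¹) * (Polynomial.bernoulli (n + 1)).map (algebraMap ℚ ℝ), ?_, ?_, ?_⟩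
  · refine (natDegree_C_mul_le _ _).trans (natDegree_map_le.trans ?_)
    rw [natDegree_le_iff_coeff_eq_zero]
    intro N hN
    rw [Polynomial.coeff_bernoulli, if_neg (by omega)]
  · rw [coeff_C_mul, coeff_map, Polynomial.coeff_bernoulli]
    simpa using hn
  · intro x
    have h := congrArg (fun q => (q.map (algebraMap ℚ ℝ)).eval x) (bernoulli_comp_one_add_X (n + 1))
    simp only [Polynomial.map_comp, eval_comp, Polynomial.map_add, Polynomial.map_one, map_X,
      eval_add, eval_one, eval_X, nsmul_eq_mul, Polynomial.map_mul, Polynomial.map_natCast,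
      Polynomial.map_pow, eval_mul, eval_natCast, eval_pow, Nat.add_sub_cancel] at h
    rw [eval_mul, eval_mul, eval_C, eval_C, h]
    push_cast
    field_simp

open Polynomial in
theorem exists_prim (Q : Polynomial ℝ) (hQ : Q ≠ 0) : ∃ S : Polynomial ℝ,
    S.natDegree = Q.natDegree + 1 ∧ S.eval 0 = 0 ∧
    ∀ x : ℝ, S.eval (1 + x) = S.eval x + Q.eval x := by
  choose T h1 h2 h3 using exists_prim_mono
  let S : Polynomial ℝ := ∑ i ∈ Finset.range (Q.natDegree + 1), C (Q.coeff i) * T i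
  have hle : S.natDegree ≤ Q.natDegree + 1 := by
    apply natDegree_sum_le_of_forall_le
    intro i hi
    have := h1 i
    have := Finset.mem_range.1 hi
    exact (natDegree_C_mul_le _ _).trans (by omega)
  have hc : S.coeff (Q.natDegree + 1) ≠ 0 := by
    have : S.coeff (Q.natDegree + 1) = Q.leadingCoeff * (T Q.natDegree).coeff (Q.natDegree + 1) := by
      simp only [S, finsetSum_coeff, coeff_C_mul]
      rw [Finset.sum_range_succ, Finset.sum_eq_zero, zero_add]
      · rfl
      intro i hi
      have := h1 i
      have := Finset.mem_range.1 hi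
      rw [coeff_eq_zero_of_natDegree_lt (p := T i) (by omega), mul_zero]
    rw [this]
    exact mul_ne_zero (leadingCoeff_ne_zero.2 hQ) (h2 _)
  refine ⟨S - C (S.eval 0), ?_, by simp, ?_⟩
  · rw [natDegree_sub_C]
    exact le_antisymm hle (le_natDegree_of_ne_zero hc)
  · intro x
    have : S.eval (1 + x) = S.eval x + Q.eval x := by
      simp only [S, eval_finsetSum, eval_mul, eval_C, h3]
      conv_rhs => rw [eval_eq_sum_range]
      rw [← Finset.sum_add_distrib]
      exact Finset.sum_congr rfl fun i _ => by ring
    rw [eval_sub, eval_sub, this, eval_C, eval_C]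
    ring

/-- with `p^{(d)}_{k,0} = 1` and
`p^{(d)}_{k,l} = (1/4) Σ_{s=0}^{k-2} (s+1)(s+1+d) p^{(d)}_{s,l-1}` for `l ≥ 1`:
(i) `μ^{(d)}_{k,l} = μ^{(d)}_{k,0} p^{(d)}_{k,l}`; (ii) for each `l` there is a
polynomial of degree `3l` with `p^{(d)}_{k,l} = P_l(k)` for all integers `k ≥ 0`. -/
theorem HarerZagier_coefficient_factorisation (d : ℕ) (hd : 1 ≤ d)
    (μ : ℤ → ℤ → ℝ)
    (h0 : μ 0 0 = 1)
    (hb : ∀ k l : ℤ, (k < 0 ∨ l < 0 ∨ l > k / 2) → μ k l = 0)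
    (hrec : ∀ k l : ℤ, 0 ≤ k →
      ((k : ℝ) + (d : ℝ) + 1) * μ (k + 1) l =
        (k : ℝ) * ((k : ℝ) + (d : ℝ) / 2) * ((k : ℝ) + (d : ℝ) / 2 - 1) * μ (k - 1) (l - 1) +
          (2 * (k : ℝ) + (d : ℝ)) * μ k l)
    (p : ℕ → ℕ → ℝ)
    (hp0 : ∀ k : ℕ, p k 0 = 1)
    (hp : ∀ k l : ℕ, p k (l + 1) =
      (1 / 4) * ∑ s ∈ Finset.range (k - 1), ((s : ℝ) + 1) * ((s : ℝ) + 1 + (d : ℝ)) * p s l) :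
    (∀ k l : ℕ, μ (k : ℤ) (l : ℤ) = μ (k : ℤ) 0 * p k l) ∧
      ∀ l : ℕ, ∃ P : Polynomial ℝ, P.natDegree = 3 * l ∧ ∀ k : ℕ, p k l = P.eval (k : ℝ) := by
  constructor
  · intro k
    induction k using Nat.strong_induction_on with
    | _ k ih =>
    intro l
    rcases l with _ | l
    · simp [hp0]
    rcases k with _ | _ | k
    · rw [hp, hb _ _ (Or.inr (Or.inr (by push_cast; omega)))]
      simp
    · rw [hp, hb _ _ (Or.inr (Or.inr (by push_cast; omega)))]
      simp
    have e1 := hrec (k + 1) (l + 1) (by omega)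
    have e2 := hrec (k + 1) 0 (by omega)
    have e3 := hrec k 0 (by omega)
    rw [hb (k + 1 - 1) (0 - 1) (by omega)] at e2
    rw [hb (k - 1) (0 - 1) (by omega)] at e3
    have i1 := ih (k + 1) (by omega) (l + 1)
    have i2 := ih k (by omega) l
    have hpk : p (k + 2) (l + 1) = p (k + 1) (l + 1)
        + 1 / 4 * (((k : ℝ) + 1) * ((k : ℝ) + 1 + d) * p k l) := by
      rw [hp, hp]
      simp only [Nat.add_sub_cancel, show k + 2 - 1 = k + 1 from rfl, Finset.sum_range_succ]
      ring
    have a1 : (k : ℤ) + 1 - 1 = k := by ring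
    have a2 : (l : ℤ) + 1 - 1 = l := by ring
    have a3 : (k : ℤ) + 1 + 1 = k + 2 := by ring
    rw [a1, a2, a3] at e1
    rw [a3] at e2
    push_cast at e1 e2 e3 i1 i2 ⊢
    have a4 : ((k : ℤ) + 1 + 1) = k + 2 := by ring
    rw [a4]
    change μ (k + 2) (l + 1) = μ (k + 2) 0 * p (k + 2) (l + 1)
    rw [hpk]
    rw [i1, i2] at e1
    have hk : ((k : ℝ) + 1 + d + 1) ≠ 0 := by positivity
    apply mul_left_cancel₀ hk
    rw [e1]
    generalize μ (k + 2) 0 = A at *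
    generalize μ (k + 1) 0 = B at *
    generalize μ k 0 = D at *
    generalize p (k + 1) (l + 1) = q at *
    generalize p k l = r at *
    linear_combination (-(q + 1 / 4 * (((k : ℝ) + 1) * ((k : ℝ) + 1 + d) * r))) * e2
      - (2 * ((k : ℝ) + 1) + d) * (1 / 4) * ((k : ℝ) + 1) * r * e3
  · intro l
    suffices H : ∃ P : Polynomial ℝ, P ≠ 0 ∧ P.natDegree = 3 * l ∧ ∀ k : ℕ, p k l = P.eval (k : ℝ) by
      obtain ⟨P, -, h⟩ := H
      exact ⟨P, h⟩
    induction l with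
    | zero => exact ⟨1, one_ne_zero, by simp, by simp [hp0]⟩
    | succ l ih =>
    obtain ⟨P, hP, hdeg, hev⟩ := ih
    have n1 : (Polynomial.X + Polynomial.C (1 : ℝ)) ≠ 0 := Polynomial.X_add_C_ne_zero _
    have n2 : (Polynomial.X + Polynomial.C (1 + d : ℝ)) ≠ 0 := Polynomial.X_add_C_ne_zero _
    obtain ⟨S, hS, hS0, hSr⟩ := exists_prim
      ((Polynomial.X + Polynomial.C (1 : ℝ)) * (Polynomial.X + Polynomial.C (1 + d : ℝ)) * P)
      (mul_ne_zero (mul_ne_zero n1 n2) hP)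
    rw [Polynomial.natDegree_mul (mul_ne_zero n1 n2) hP, Polynomial.natDegree_mul n1 n2,
      Polynomial.natDegree_X_add_C, Polynomial.natDegree_X_add_C, hdeg] at hS
    have hD : (Polynomial.C (1 / 4 : ℝ) * S.comp (Polynomial.X - Polynomial.C 1)).natDegree
        = 3 * (l + 1) := by
      rw [Polynomial.natDegree_C_mul (by norm_num), Polynomial.natDegree_comp,
        Polynomial.natDegree_X_sub_C, hS]
      ring
    have hsum : ∀ n : ℕ, ∑ s ∈ Finset.range n, ((s : ℝ) + 1) * ((s : ℝ) + 1 + (d : ℝ)) * p s l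
        = S.eval (n : ℝ) := by
      intro n
      induction n with
      | zero => simp [hS0]
      | succ n ihn =>
        have h := hSr n
        rw [Finset.sum_range_succ, ihn, hev]
        push_cast
        rw [add_comm (n : ℝ) 1, h]
        simp only [Polynomial.eval_mul, Polynomial.eval_add, Polynomial.eval_X, Polynomial.eval_C]
        ring
    refine ⟨_, ?_, hD, ?_⟩
    · intro h0
      rw [h0] at hD
      simp at hD
    · intro k
      rw [hp, hsum]
      rcases k with _ | k
      · have h := hSr (-1)
        simp [hS0] at h
        simp [hS0, ← h]
      · simp
end

section
/- For every integer d ≥ 1, every integer M ≥ 0 and every real k with k > -d/2, the integral (1/N_0) ∫_{ℝ^d} ‖x‖^{2k} ρ^{M,d}(x) dx converges and equals (Γ(d/2 + k)/Γ(d/2)) · Σ_{l=0}^{M} ( (-k)_l (-M)_l / ( l! (d+1)_l ) ) 2^l, where (a)_l = a(a+1)⋯(a+l-1) is the rising factorial; that is, the moment equals (Γ(d/2+k)/Γ(d/2)) · ₂F₁(-k, -M; d+1; 2). -/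
open MeasureTheory Real

namespace FermiAux

open PowerSeries in
theorem coeff_cubic (A : PowerSeries ℝ) :
    coeff 0 ((1 - X) * (1 + X) ^ 2 * A) = coeff 0 A ∧
    coeff 1 ((1 - X) * (1 + X) ^ 2 * A) = coeff 1 A + coeff 0 A ∧
    coeff 2 ((1 - X) * (1 + X) ^ 2 * A) = coeff 2 A + coeff 1 A - coeff 0 A ∧
    ∀ n, coeff (n + 3) ((1 - X) * (1 + X) ^ 2 * A) =
      coeff (n + 3) A + coeff (n + 2) A - coeff (n + 1) A - coeff n A := by
  have e : (1 - X) * (1 + X) ^ 2 * A = A + X * (A - X * (A + X * A)) := by ring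
  rw [e]
  refine ⟨by simp, ?_, ?_, fun n => ?_⟩
  · rw [map_add, show (1 : ℕ) = 0 + 1 from rfl, coeff_succ_X_mul]; simp
  · rw [map_add, show (2 : ℕ) = 0 + 1 + 1 from rfl, coeff_succ_X_mul, map_sub, coeff_succ_X_mul]
    simp; ring
  · rw [map_add, show n + 3 = n + 1 + 1 + 1 from rfl, coeff_succ_X_mul, map_sub, coeff_succ_X_mul,
      map_add, coeff_succ_X_mul]
    ring

open PowerSeries in
theorem coeff_quad (A : PowerSeries ℝ) (a b c : ℝ) :
    coeff 0 ((C a + C b * X + C c * X ^ 2) * A) = a * coeff 0 A ∧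
    coeff 1 ((C a + C b * X + C c * X ^ 2) * A) = a * coeff 1 A + b * coeff 0 A ∧
    ∀ n, coeff (n + 2) ((C a + C b * X + C c * X ^ 2) * A) =
      a * coeff (n + 2) A + b * coeff (n + 1) A + c * coeff n A := by
  have e : (C a + C b * X + C c * X ^ 2) * A = C a * A + X * (C b * A + X * (C c * A)) := by ring
  rw [e]
  refine ⟨by simp, ?_, fun n => ?_⟩
  · rw [map_add, show (1 : ℕ) = 0 + 1 from rfl, coeff_succ_X_mul]; simp
  · rw [map_add, show n + 2 = n + 1 + 1 from rfl, coeff_succ_X_mul, map_add, coeff_succ_X_mul]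
    simp only [coeff_C_mul]; ring

/-- 1D series -/
noncomputable def hn (n : ℕ) (x : ℝ) : ℝ := hermiteH n x ^ 2 / (2 ^ n * (Nat.factorial n : ℝ))

noncomputable def gs (x : ℝ) : PowerSeries ℝ := PowerSeries.mk fun n => hn n x

theorem hn_rec (n : ℕ) (x : ℝ) :
    (n + 3 : ℝ) * hn (n + 3) x + (n + 2 - 2 * x ^ 2) * hn (n + 2) x =
      (n + 2 - 2 * x ^ 2) * hn (n + 1) x + (n + 1) * hn n x := by
  have h3 : hermiteH (n + 3) x = 2 * x * hermiteH (n + 2) x - 2 * (n + 2) * hermiteH (n + 1) x := by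
    rw [show n + 3 = (n + 1) + 2 from rfl, hermiteH]; push_cast; ring
  have h2 : hermiteH (n + 2) x = 2 * x * hermiteH (n + 1) x - 2 * (n + 1) * hermiteH n x := by
    rw [hermiteH]
  have f : (Nat.factorial n : ℝ) ≠ 0 := by positivity
  have p : (2 : ℝ) ^ n ≠ 0 := by positivity
  have q1 : (n : ℝ) + 1 ≠ 0 := by positivity
  have q2 : (n : ℝ) + 2 ≠ 0 := by positivity
  have q3 : (n : ℝ) + 3 ≠ 0 := by positivity
  have f1 : ((n + 1).factorial : ℝ) = (n + 1) * n.factorial := by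
    rw [Nat.factorial_succ]; push_cast; ring
  have f2 : ((n + 2).factorial : ℝ) = (n + 2) * ((n + 1) * n.factorial) := by
    rw [Nat.factorial_succ, Nat.factorial_succ]; push_cast; ring
  have f3 : ((n + 3).factorial : ℝ) = (n + 3) * ((n + 2) * ((n + 1) * n.factorial)) := by
    rw [Nat.factorial_succ, Nat.factorial_succ, Nat.factorial_succ]; push_cast; ring
  simp only [hn, f1, f2, f3, pow_add, h3]
  rw [h2]
  field_simp
  ring

open PowerSeries in
theorem gs_ode (x : ℝ) :
    (1 - X) * (1 + X) ^ 2 * derivative ℝ (gs x) =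
      (X * (1 + X) + C (2 * x ^ 2) * (1 - X)) * gs x := by
  have e : (X * (1 + X) + C (2 * x ^ 2) * (1 - X) : PowerSeries ℝ) =
      C (2 * x ^ 2) + C (1 - 2 * x ^ 2) * X + C 1 * X ^ 2 := by
    simp only [map_sub, map_one]; ring
  rw [e]
  obtain ⟨a0, a1, a2, a3⟩ := coeff_cubic (derivative ℝ (gs x))
  obtain ⟨b0, b1, b2⟩ := coeff_quad (gs x) (2 * x ^ 2) (1 - 2 * x ^ 2) 1
  ext n
  match n with
  | 0 =>
    rw [a0, b0]; simp [coeff_derivative, gs, hn, hermiteH]; ring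
  | 1 =>
    rw [a1, b1]; simp [coeff_derivative, gs, hn, hermiteH, Nat.factorial]; ring
  | 2 =>
    rw [a2, b2 0]
    have := hn_rec 0 x
    simp only [coeff_derivative, gs, coeff_mk]
    push_cast at *
    linear_combination this
  | n + 3 =>
    rw [a3, b2 (n + 1)]
    have := hn_rec (n + 1) x
    simp only [coeff_derivative, gs, coeff_mk]
    push_cast at *
    ring_nf at this ⊢
    linear_combination this

open PowerSeries in
theorem prod_ode {ι : Type*} (s : Finset ι) (x : ι → ℝ) :
    (1 - X) * (1 + X) ^ 2 * derivative ℝ (∏ j ∈ s, gs (x j)) =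
      (C (s.card : ℝ) * (X * (1 + X)) + C (2 * ∑ j ∈ s, x j ^ 2) * (1 - X)) * ∏ j ∈ s, gs (x j) := by
  classical
  induction s using Finset.induction_on with
  | empty => simp
  | insert a s ha ih =>
    rw [Finset.prod_insert ha, Finset.sum_insert ha, Finset.card_insert_of_notMem ha,
      Derivation.leibniz, smul_eq_mul, smul_eq_mul]
    have := gs_ode (x a)
    simp only [mul_add, map_add, Nat.cast_add, Nat.cast_one, map_one] at *
    linear_combination (gs (x a)) * ih + (∏ j ∈ s, gs (x j)) * this

noncomputable def rs {ι : Type*} [Fintype ι] (x : ι → ℝ) : PowerSeries ℝ :=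
  PowerSeries.mk 1 * ∏ j, gs (x j)

/-- The master differential equation. -/
def Ode (d : ℕ) (R S : PowerSeries ℝ) : Prop :=
  (1 - PowerSeries.X) * (1 + PowerSeries.X) ^ 2 * PowerSeries.derivative ℝ R =
    (PowerSeries.C (d : ℝ) * (PowerSeries.X * (1 + PowerSeries.X)) + (1 + PowerSeries.X) ^ 2) * R
      + PowerSeries.C 2 * (1 - PowerSeries.X) * S

open PowerSeries in
theorem rs_ode {d : ℕ} (x : Fin d → ℝ) : Ode d (rs x) (C (∑ j, x j ^ 2) * rs x) := by
  unfold Ode rs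
  have h1 := prod_ode Finset.univ x
  have h2 : (mk 1 : PowerSeries ℝ) * (1 - X) = 1 := mk_one_mul_one_sub_eq_one ℝ
  have h3 : derivative ℝ (PowerSeries.mk 1 : PowerSeries ℝ) * (1 - X) = (PowerSeries.mk 1 : PowerSeries ℝ) := by
    have := congrArg (derivative ℝ) h2
    rw [Derivation.leibniz] at this
    simp [smul_eq_mul, derivative_X] at this
    linear_combination this
  rw [Derivation.leibniz, smul_eq_mul, smul_eq_mul]
  simp only [Finset.card_univ, Fintype.card_fin, map_mul] at h1 ⊢
  linear_combination (PowerSeries.mk 1 : PowerSeries ℝ) * h1 + (1 + X) ^ 2 * (∏ j, gs (x j)) * h3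

open PowerSeries in
theorem ode_rec (d n : ℕ) : ∃ a0 a1 a2 b0 b1 : ℝ, ∀ R S : PowerSeries ℝ, Ode d R S →
    coeff (n + 1) R = a0 * coeff n R + a1 * coeff (n - 1) R + a2 * coeff (n - 2) R
      + b0 * coeff n S + b1 * coeff (n - 1) S := by
  have e : (C (d : ℝ) * (X * (1 + X)) + (1 + X) ^ 2 : PowerSeries ℝ) =
      C 1 + C (d + 2 : ℝ) * X + C (d + 1 : ℝ) * X ^ 2 := by
    simp only [map_add, map_one, map_ofNat]; ring
  have e' : (C 2 * (1 - X) : PowerSeries ℝ) = C 2 + C (-2) * X + C 0 * X ^ 2 := by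
    simp only [map_neg, map_zero]; ring
  have key : ∀ R S : PowerSeries ℝ, Ode d R S → ∀ m,
      coeff m ((1 - X) * (1 + X) ^ 2 * derivative ℝ R) =
      coeff m ((C 1 + C (d + 2 : ℝ) * X + C (d + 1 : ℝ) * X ^ 2) * R)
      + coeff m ((C 2 + C (-2) * X + C 0 * X ^ 2) * S) := by
    intro R S h m
    rw [← map_add, ← e, ← e']
    exact congrArg _ h
  match n with
  | 0 =>
    refine ⟨1, 0, 0, 2, 0, fun R S h => ?_⟩
    have := key R S h 0
    rw [(coeff_cubic _).1, (coeff_quad _ _ _ _).1, (coeff_quad _ _ _ _).1, coeff_derivative] at this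
    push_cast at this
    linear_combination this
  | 1 =>
    refine ⟨0, (d + 2) / 2, 0, 1, -1, fun R S h => ?_⟩
    have := key R S h 1
    rw [(coeff_cubic _).2.1, (coeff_quad _ _ _ _).2.1, (coeff_quad _ _ _ _).2.1, coeff_derivative,
      coeff_derivative] at this
    push_cast at this
    simp only [Nat.sub_self]
    linear_combination this / 2
  | 2 =>
    refine ⟨-1 / 3, (d + 3) / 3, (d + 1) / 3, 2 / 3, -2 / 3, fun R S h => ?_⟩
    have := key R S h 2
    rw [(coeff_cubic _).2.2.1, (coeff_quad _ _ _ _).2.2 0, (coeff_quad _ _ _ _).2.2 0,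
      coeff_derivative, coeff_derivative, coeff_derivative] at this
    push_cast at this
    simp only [Nat.sub_self, show 2 - 1 = 1 from rfl] at *
    norm_num at this ⊢
    linear_combination this / 3
  | n + 3 =>
    have q : (n : ℝ) + 4 ≠ 0 := by positivity
    refine ⟨(1 - (n + 3)) / (n + 4), (d + 2 + (n + 2)) / (n + 4), (d + 1 + (n + 1)) / (n + 4),
      2 / (n + 4), -2 / (n + 4), fun R S h => ?_⟩
    have := key R S h (n + 3)
    rw [(coeff_cubic _).2.2.2, (coeff_quad _ _ _ _).2.2 (n + 1), (coeff_quad _ _ _ _).2.2 (n + 1),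
      coeff_derivative, coeff_derivative, coeff_derivative, coeff_derivative] at this
    simp only [show n + 3 - 1 = n + 2 from rfl, show n + 3 - 2 = n + 1 from rfl,
      show n + 1 + 2 = n + 3 from rfl, show n + 2 + 1 = n + 3 from rfl,
      show n + 1 + 1 = n + 2 from rfl, show n + 3 + 1 = n + 4 from rfl] at *
    push_cast at this
    field_simp
    linear_combination this

/-! closed form -/

noncomputable def cb (k : ℝ) (l : ℕ) : ℝ := ∏ i ∈ Finset.range l, (k - i) / (i + 1)

theorem cb_succ (k : ℝ) (l : ℕ) : cb k (l + 1) * (l + 1) = cb k l * (k - l) := by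
  rw [cb, Finset.prod_range_succ, ← cb]
  have : (l : ℝ) + 1 ≠ 0 := by positivity
  field_simp

theorem cb_absorb (k : ℝ) (l : ℕ) : cb (k + 1) (l + 1) * (l + 1) = (k + 1) * cb k l := by
  induction l with
  | zero => simp [cb]
  | succ l ih =>
    have h1 := cb_succ (k + 1) (l + 1)
    have h2 := cb_succ k l
    have : (l : ℝ) + 1 ≠ 0 := by positivity
    push_cast at *
    apply mul_right_cancel₀ this
    linear_combination (l + 1) * h1 + (k - l) * ih - (k + 1) * h2

theorem cb_pascal (k : ℝ) (l : ℕ) : cb (k + 1) (l + 1) = cb k (l + 1) + cb k l := by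
  have : (l : ℝ) + 1 ≠ 0 := by positivity
  apply mul_right_cancel₀ this
  linear_combination cb_absorb k l - cb_succ k l

theorem choose_r (m p : ℕ) :
    (Nat.choose m (p + 1) : ℝ) * (p + 1) = Nat.choose m p * ((m : ℝ) - p) := by
  have h := Nat.choose_succ_right_eq m p
  rcases le_or_gt p m with hp | hp
  · have : ((m - p : ℕ) : ℝ) = m - p := Nat.cast_sub hp
    rw [← this]; exact_mod_cast h
  · simp [Nat.choose_eq_zero_of_lt hp, Nat.choose_eq_zero_of_lt (Nat.lt_succ_of_lt hp)]

theorem choose_r' (m p : ℕ) :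
    ((m : ℝ) + 1) * Nat.choose m p = Nat.choose (m + 1) p * ((m : ℝ) + 1 - p) := by
  have h := Nat.choose_mul_succ_eq m p
  rcases le_or_gt p (m + 1) with hp | hp
  · have : ((m + 1 - p : ℕ) : ℝ) = m + 1 - p := by rw [Nat.cast_sub hp]; push_cast; ring
    rw [← this, mul_comm]; exact_mod_cast h
  · simp [Nat.choose_eq_zero_of_lt hp, Nat.choose_eq_zero_of_lt (show m < p by omega)]

noncomputable def ut (d : ℕ) (k : ℝ) (n l : ℕ) : ℝ := cb k l * 2 ^ l * Nat.choose (n + d) (d + l)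

noncomputable def cc (d : ℕ) (k : ℝ) (n : ℕ) : ℝ := ∑ l ∈ Finset.range (n + 1), ut d k n l

theorem ut_zero (d : ℕ) (k : ℝ) {n l : ℕ} (h : n < l) : ut d k n l = 0 := by
  simp [ut, Nat.choose_eq_zero_of_lt (show n + d < d + l by omega)]

theorem cc_eq (d : ℕ) (k : ℝ) {n N : ℕ} (h : n < N) : cc d k n = ∑ l ∈ Finset.range N, ut d k n l := by
  unfold cc
  apply Finset.sum_subset
  · intro i; simp; omega
  · intro i _ hi
    apply ut_zero
    simpa using hi

theorem cc_b (d : ℕ) (k : ℝ) (n : ℕ) :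
    cc d (k + 1) (n + 1) - cc d (k + 1) n = cc d k (n + 1) + cc d k n := by
  rw [cc_eq d k (show n + 1 < n + 2 + 1 by omega), cc_eq d k (show n < n + 2 + 1 by omega),
    cc_eq d (k + 1) (show n + 1 < n + 2 + 1 by omega), cc_eq d (k + 1) (show n < n + 2 + 1 by omega)]
  rw [← sub_eq_zero, ← Finset.sum_sub_distrib, ← Finset.sum_add_distrib, ← Finset.sum_sub_distrib,
    Finset.sum_range_succ']
  have : ∀ l ∈ Finset.range (n + 2),
      ut d (k + 1) (n + 1) (l + 1) - ut d (k + 1) n (l + 1) -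
        (ut d k (n + 1) (l + 1) + ut d k n (l + 1)) =
      (-2 * ut d k n (l + 1)) - (-2 * ut d k n l) := by
    intro l _
    have h : (Nat.choose (n + 1 + d) (d + (l + 1)) : ℝ) =
        Nat.choose (n + d) (d + l) + Nat.choose (n + d) (d + (l + 1)) := by
      rw [show n + 1 + d = (n + d) + 1 by ring, show d + (l + 1) = (d + l) + 1 by ring,
        Nat.choose_succ_succ]; push_cast; ring
    simp only [ut, cb_pascal, h]
    ring
  rw [Finset.sum_congr rfl this, Finset.sum_range_sub (fun l => -2 * ut d k n l),
    ut_zero d k (show n < n + 2 by omega)]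
  simp [ut, cb]
  ring

theorem cc_a (d : ℕ) (k : ℝ) (n : ℕ) :
    (n + 2 : ℝ) * cc d k (n + 2) = (1 + d + 2 * k) * cc d k (n + 1) + (n + 1 + d) * cc d k n := by
  rw [cc_eq d k (show n + 2 < n + 3 + 1 by omega), cc_eq d k (show n + 1 < n + 3 + 1 by omega),
    cc_eq d k (show n < n + 3 + 1 by omega)]
  rw [← sub_eq_zero, Finset.mul_sum, Finset.mul_sum, Finset.mul_sum, ← Finset.sum_add_distrib,
    ← Finset.sum_sub_distrib]
  have : ∀ l ∈ Finset.range (n + 3 + 1),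
      (n + 2 : ℝ) * ut d k (n + 2) l -
        ((1 + d + 2 * k) * ut d k (n + 1) l + (n + 1 + d) * ut d k n l) =
      (-(((l + 1 : ℕ) : ℝ) * cb k (l + 1) * 2 ^ (l + 1) * Nat.choose (n + 1 + d) (d + (l + 1) - 1)))
       - (-((l : ℝ) * cb k l * 2 ^ l * Nat.choose (n + 1 + d) (d + l - 1))) := by
    intro l _
    have hc := cb_succ k l
    have idt : (n + 2 : ℝ) * Nat.choose (n + 2 + d) (d + l) =
        (1 + d + 2 * l) * Nat.choose (n + 1 + d) (d + l) + (n + 1 + d) * Nat.choose (n + d) (d + l)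
        + l * Nat.choose (n + 1 + d) (d + l - 1) := by
      have g1 := choose_r' (n + d) (d + l)
      rw [show n + d + 1 = n + 1 + d by ring] at g1
      cases l with
      | zero =>
        have g2 := choose_r' (n + 1 + d) d
        rw [show n + 1 + d + 1 = n + 2 + d by ring] at g2
        simp only [Nat.add_zero] at *
        push_cast at *
        linear_combination -g2 - g1
      | succ l =>
        have g2 := choose_r (n + 1 + d) (d + l)
        have g3 : (Nat.choose (n + 2 + d) (d + (l + 1)) : ℝ) =
          Nat.choose (n + 1 + d) (d + l) + Nat.choose (n + 1 + d) (d + (l + 1)) := by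
          rw [show n + 2 + d = (n + 1 + d) + 1 by ring, show d + (l + 1) = (d + l) + 1 by ring,
            Nat.choose_succ_succ]; push_cast; ring
        rw [g3]
        simp only [show d + (l + 1) - 1 = d + l from rfl, show d + l + 1 = d + (l + 1) from rfl] at *
        push_cast at *
        linear_combination -g2 - g1
    simp only [ut, show d + (l + 1) - 1 = d + l from rfl, pow_succ]
    push_cast
    linear_combination cb k l * 2 ^ l * idt +
      2 * 2 ^ l * (Nat.choose (n + 1 + d) (d + l) : ℝ) * hc
  rw [Finset.sum_congr rfl this, Finset.sum_range_sub (fun l : ℕ =>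
    (-((l : ℝ) * cb k l * 2 ^ l * Nat.choose (n + 1 + d) (d + l - 1))))]
  simp [Nat.choose_eq_zero_of_lt (show n + 1 + d < d + (n + 3) by omega)]

noncomputable def cs (d : ℕ) (k : ℝ) : PowerSeries ℝ := PowerSeries.mk fun n => cc d k n

open PowerSeries in
theorem cs_ode (d : ℕ) (k : ℝ) : Ode d (cs d k) (C ((d : ℝ) / 2 + k) * cs d (k + 1)) := by
  have hb : cs d (k + 1) * (1 - X) = cs d k * (1 + X) := by
    ext n
    rw [mul_sub, mul_add, mul_one, mul_one, map_sub, map_add]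
    cases n with
    | zero => simp [cs, cc, ut, cb]
    | succ n => 
      rw [coeff_succ_mul_X, coeff_succ_mul_X]
      simpa [cs] using cc_b d k n
  have ha : (1 - X ^ 2) * derivative ℝ (cs d k) = C (1 + d + 2 * k) * cs d k + C (1 + d : ℝ) * (X * cs d k) := by
    have e : (1 - X ^ 2) * derivative ℝ (cs d k) = derivative ℝ (cs d k) - X * (X * derivative ℝ (cs d k)) := by ring
    rw [e]
    ext n
    rw [map_sub, map_add, coeff_C_mul, coeff_C_mul]
    match n with
    | 0 => 
      simp [cs, cc, ut, cb, coeff_derivative, Finset.sum_range_succ]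
      rw [add_comm 1 d, Nat.choose_succ_self_right, Nat.choose_self]; push_cast; ring
    | 1 =>
      have := cc_a d k 0
      rw [coeff_succ_X_mul, coeff_succ_X_mul]
      simp [cs, coeff_derivative] at *
      linear_combination this
    | n + 2 => 
      have := cc_a d k (n + 1)
      rw [coeff_succ_X_mul, coeff_succ_X_mul, coeff_succ_X_mul]
      simp [cs, coeff_derivative] at *
      ring_nf at *
      linear_combination this
  unfold Ode
  simp only [map_add, map_mul, map_one] at ha ⊢
  have h2 : (C (2 : ℝ) : PowerSeries ℝ) * C ((d : ℝ) / 2) = C (d : ℝ) := by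
    rw [← map_mul]; congr 1; ring
  linear_combination (1 + X) * ha - (C (d : ℝ) + C 2 * C k) * hb - ((1 - X) * cs d (k + 1)) * h2

theorem cc_zero (d : ℕ) (k : ℝ) : cc d k 0 = 1 := by simp [cc, ut, cb]

theorem sum_filter_eq (d M : ℕ) (x : Fin d → ℝ) :
    ∑ l ∈ Finset.filter (fun l => ∑ j, l j ≤ M)
      (Fintype.piFinset fun _ : Fin d => Finset.range (M + 1)), ∏ j, hn (l j) (x j) =
    PowerSeries.coeff M (rs x) := by
  rw [rs, PowerSeries.coeff_mul, Finset.Nat.sum_antidiagonal_eq_sum_range_succ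
    (fun a b => PowerSeries.coeff a (PowerSeries.mk 1 : PowerSeries ℝ) *
      PowerSeries.coeff b (∏ j, gs (x j))), ← Finset.sum_range_reflect]
  rw [← Finset.sum_fiberwise_of_maps_to (t := Finset.range (M + 1)) (g := fun l => ∑ j, l j)
    (by intro l hl; simp at hl ⊢; omega)]
  apply Finset.sum_congr rfl
  intro m hm
  have hm' : m ≤ M := by simp at hm; omega
  rw [show M - (M + 1 - 1 - m) = m by omega, PowerSeries.coeff_prod]
  simp only [PowerSeries.coeff_mk, Pi.one_apply, one_mul, gs]
  refine Finset.sum_bij' (fun l _ => Finsupp.equivFunOnFinite.symm l) (fun l _ => (l : Fin d → ℕ))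
    ?_ ?_ ?_ ?_ ?_
  · intro l hl
    simp at hl ⊢
    exact hl.2
  · intro l hl
    simp at hl ⊢
    have hl' : ∑ j, l j = m := hl
    refine ⟨⟨fun j => ?_, by omega⟩, hl'⟩
    have := Finset.single_le_sum (f := fun j => l j) (fun i _ => Nat.zero_le _) (Finset.mem_univ j)
    omega
  · intro l hl; rfl
  · intro l hl; ext; rfl
  · intro l hl; rfl

theorem psi_sq (l : ℕ) (x : ℝ) : ψho l x ^ 2 = (√π)⁻¹ * hn l x * Real.exp (-x ^ 2) := by
  have h : (√(2 ^ l * (Nat.factorial l) * √π)) ^ 2 = 2 ^ l * (Nat.factorial l) * √π :=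
    Real.sq_sqrt (by positivity)
  have e : Real.exp (-x ^ 2) = Real.exp (-x ^ 2 / 2) ^ 2 := by
    rw [← Real.exp_nat_mul]; congr 1; push_cast; ring
  rw [ψho, mul_pow, mul_pow, inv_pow, h, hn, e, mul_inv]
  ring

theorem density_eq (d M : ℕ) (x : EuclideanSpace ℝ (Fin d)) :
    fermiDensity d M x = (√π ^ d)⁻¹ * (PowerSeries.coeff M (rs (fun j => x j)) * Real.exp (-‖x‖ ^ 2)) := by
  rw [fermiDensity, ← sum_filter_eq, Finset.sum_mul, Finset.mul_sum]
  apply Finset.sum_congr rfl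
  intro l _
  simp only [psi_sq]
  rw [Finset.prod_mul_distrib, Finset.prod_mul_distrib, ← Real.exp_sum, EuclideanSpace.real_norm_sq_eq]
  simp [Finset.sum_neg_distrib]
  ring

noncomputable def KK (d : ℕ) (k : ℝ) : ℝ :=
  √π ^ d * (Real.Gamma ((d : ℝ) / 2 + k) / Real.Gamma ((d : ℝ) / 2))

theorem KK_succ (d : ℕ) (k : ℝ) (hk : -(d : ℝ) / 2 < k) :
    KK d (k + 1) = ((d : ℝ) / 2 + k) * KK d k := by
  unfold KK
  rw [← add_assoc, Real.Gamma_add_one (by linarith)]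
  ring

def HI (d : ℕ) (k : ℝ) (f : EuclideanSpace ℝ (Fin d) → ℝ) (v : ℝ) : Prop :=
  Integrable (fun x : EuclideanSpace ℝ (Fin d) => ‖x‖ ^ (2 * k) * (f x * Real.exp (-‖x‖ ^ 2))) ∧
    ∫ x : EuclideanSpace ℝ (Fin d), ‖x‖ ^ (2 * k) * (f x * Real.exp (-‖x‖ ^ 2)) = v

theorem HI.add {d k f g v w} (hf : HI d k f v) (hg : HI d k g w) :
    HI d k (fun x => f x + g x) (v + w) := by
  have e : (fun x : EuclideanSpace ℝ (Fin d) => ‖x‖ ^ (2 * k) * ((f x + g x) * Real.exp (-‖x‖ ^ 2)))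
    = fun x => ‖x‖ ^ (2 * k) * (f x * Real.exp (-‖x‖ ^ 2)) +
      ‖x‖ ^ (2 * k) * (g x * Real.exp (-‖x‖ ^ 2)) := by
    funext x; ring
  unfold HI
  rw [e, integral_add hf.1 hg.1, hf.2, hg.2]
  exact ⟨hf.1.add hg.1, rfl⟩

theorem HI.smul {d k f v} (c : ℝ) (hf : HI d k f v) :
    HI d k (fun x => c * f x) (c * v) := by
  have e : (fun x : EuclideanSpace ℝ (Fin d) => ‖x‖ ^ (2 * k) * ((c * f x) * Real.exp (-‖x‖ ^ 2)))
    = fun x => c * (‖x‖ ^ (2 * k) * (f x * Real.exp (-‖x‖ ^ 2))) := by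
    funext x; ring
  unfold HI
  rw [e, integral_const_mul, hf.2]
  exact ⟨hf.1.const_mul c, rfl⟩

theorem HI.shift {d k f v} (hd : 1 ≤ d) (hf : HI d (k + 1) f v) :
    HI d k (fun x => ‖x‖ ^ 2 * f x) v := by
  have : Nonempty (Fin d) := ⟨⟨0, hd⟩⟩
  have : Nontrivial (EuclideanSpace ℝ (Fin d)) := inferInstance
  have e : (fun x : EuclideanSpace ℝ (Fin d) => ‖x‖ ^ (2 * (k + 1)) * (f x * Real.exp (-‖x‖ ^ 2)))
    =ᵐ[volume] fun x => ‖x‖ ^ (2 * k) * ((‖x‖ ^ 2 * f x) * Real.exp (-‖x‖ ^ 2)) := by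
    have h0 : ∀ᵐ x : EuclideanSpace ℝ (Fin d), x ≠ 0 := by
      simp [ae_iff]
    filter_upwards [h0] with x hx
    have hp : 0 < ‖x‖ := norm_pos_iff.mpr hx
    rw [mul_add, Real.rpow_add hp, mul_one, Real.rpow_two]
    ring
  exact ⟨hf.1.congr e, by rw [← integral_congr_ae e, hf.2]⟩

theorem HI.base (d : ℕ) (hd : 1 ≤ d) (k : ℝ) (hk : -(d : ℝ) / 2 < k) :
    HI d k (fun _ => 1) (KK d k) := by
  have : Nonempty (Fin d) := ⟨⟨0, hd⟩⟩
  have : Nontrivial (EuclideanSpace ℝ (Fin d)) := inferInstance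
  have hd' : (1 : ℝ) ≤ d := by exact_mod_cast hd
  have hs : -1 < (d : ℝ) - 1 + 2 * k := by linarith
  have e : Set.EqOn (fun y : ℝ => y ^ (d - 1) • (y ^ (2 * k) * (1 * Real.exp (-y ^ 2))))
      (fun y : ℝ => y ^ ((d : ℝ) - 1 + 2 * k) * Real.exp (-y ^ (2 : ℝ))) (Set.Ioi 0) := by
    intro y hy
    have hy' : (0 : ℝ) < y := hy
    simp only [smul_eq_mul]
    rw [Real.rpow_add hy', Real.rpow_two, ← Real.rpow_natCast y (d - 1), Nat.cast_sub hd]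
    push_cast; ring
  constructor
  · refine (integrable_fun_norm_addHaar volume
      (f := fun y : ℝ => y ^ (2 * k) * (1 * Real.exp (-y ^ 2)))).2 ?_
    rw [finrank_euclideanSpace, Fintype.card_fin, integrableOn_congr_fun e measurableSet_Ioi]
    exact integrableOn_rpow_mul_exp_neg_rpow hs two_pos
  · rw [integral_fun_norm_addHaar volume (fun y : ℝ => y ^ (2 * k) * (1 * Real.exp (-y ^ 2))),
      finrank_euclideanSpace, Fintype.card_fin, setIntegral_congr_fun measurableSet_Ioi e,
      integral_rpow_mul_exp_neg_rpow two_pos hs, Measure.real, EuclideanSpace.volume_ball]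
    have hG : Real.Gamma ((d : ℝ) / 2 + 1) = d / 2 * Real.Gamma ((d : ℝ) / 2) :=
      Real.Gamma_add_one (by positivity)
    have hG0 : 0 < Real.Gamma ((d : ℝ) / 2) := Real.Gamma_pos_of_pos (by positivity)
    rw [Fintype.card_fin, hG, ENNReal.ofReal_one, one_pow, one_mul,
      ENNReal.toReal_ofReal (by positivity), KK,
      show ((d : ℝ) - 1 + 2 * k + 1) / 2 = (d : ℝ) / 2 + k by ring]
    simp only [nsmul_eq_mul, smul_eq_mul]
    field_simp

theorem rs_zero {d : ℕ} (x : Fin d → ℝ) : PowerSeries.coeff 0 (rs x) = 1 := by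
  rw [← sum_filter_eq]
  have : Finset.filter (fun l : Fin d → ℕ => ∑ j, l j ≤ 0)
      (Fintype.piFinset fun _ : Fin d => Finset.range (0 + 1)) = {0} := by
    ext l
    simp [funext_iff]
  rw [this]
  simp [hn, hermiteH]

theorem moment (d : ℕ) (hd : 1 ≤ d) (n : ℕ) : ∀ k : ℝ, -(d : ℝ) / 2 < k →
    HI d k (fun x => PowerSeries.coeff n (rs (fun j => x j))) (KK d k * cc d k n) := by
  induction n using Nat.strong_induction_on with
  | _ n ih =>
  intro k hk
  cases n with
  | zero =>
    simp only [rs_zero, cc_zero, mul_one]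
    exact HI.base d hd k hk
  | succ n =>
    obtain ⟨a0, a1, a2, b0, b1, h⟩ := ode_rec d n
    have i0 := (ih n (by omega) k hk).smul a0
    have i1 := (ih (n - 1) (by omega) k hk).smul a1
    have i2 := (ih (n - 2) (by omega) k hk).smul a2
    have j0 := ((ih n (by omega) (k + 1) (by linarith)).shift hd).smul b0
    have j1 := ((ih (n - 1) (by omega) (k + 1) (by linarith)).shift hd).smul b1
    have key := (((i0.add i1).add i2).add j0).add j1
    have hc := h _ _ (cs_ode d k)
    simp only [cs, PowerSeries.coeff_C_mul, PowerSeries.coeff_mk] at hc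
    have hr : ∀ x : EuclideanSpace ℝ (Fin d), _ := fun x => h _ _ (rs_ode (fun j => x j))
    simp only [PowerSeries.coeff_C_mul, ← EuclideanSpace.real_norm_sq_eq] at hr
    simp only [hr]
    convert key using 1
    rw [hc, KK_succ d k hk]
    ring

theorem cc_final (d M : ℕ) (k : ℝ) :
    1 / (Nat.choose (M + d) d : ℝ) * cc d k M = ∑ l ∈ Finset.range (M + 1),
            ((∏ i ∈ Finset.range l, (-k + (i : ℝ))) *
                (∏ i ∈ Finset.range l, (-(M : ℝ) + (i : ℝ))) /
              ((Nat.factorial l : ℝ) * ∏ i ∈ Finset.range l, ((d : ℝ) + 1 + (i : ℝ)))) *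
                2 ^ l := by
  have hN : (Nat.choose (M + d) d : ℝ) ≠ 0 := by
    exact_mod_cast (Nat.choose_pos (Nat.le_add_left d M)).ne'
  rw [cc, Finset.mul_sum]
  apply Finset.sum_congr rfl
  intro l _
  rw [ut]
  suffices h : cb k l * Nat.choose (M + d) (d + l) = Nat.choose (M + d) d *
     ((∏ i ∈ Finset.range l, (-k + (i : ℝ))) *
                (∏ i ∈ Finset.range l, (-(M : ℝ) + (i : ℝ))) /
              ((Nat.factorial l : ℝ) * ∏ i ∈ Finset.range l, ((d : ℝ) + 1 + (i : ℝ)))) by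
    rw [one_div, inv_mul_eq_iff_eq_mul₀ hN, ← mul_assoc, ← h]
    ring
  induction l with
  | zero => simp [cb]
  | succ l ih =>
    have h1 := cb_succ k l
    have h2 := choose_r (M + d) (d + l)
    rw [show d + l + 1 = d + (l + 1) by ring] at h2
    have q1 : (l : ℝ) + 1 ≠ 0 := by positivity
    have q2 : (d : ℝ) + 1 + l ≠ 0 := by positivity
    have hc : cb k (l + 1) = cb k l * (k - l) / (l + 1) := by rw [← h1]; field_simp
    have hd : (Nat.choose (M + d) (d + (l + 1)) : ℝ) =
        Nat.choose (M + d) (d + l) * ((M : ℝ) - l) / (d + 1 + l) := by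
      rw [eq_div_iff q2]; push_cast at h2; linear_combination h2
    have e : cb k (l + 1) * Nat.choose (M + d) (d + (l + 1)) =
      (cb k l * Nat.choose (M + d) (d + l)) * ((-k + l) * (-(M : ℝ) + l) / ((l + 1) * (d + 1 + l))) := by
      rw [hc, hd]; field_simp; ring
    rw [e, ih (by simp at *; omega), Finset.prod_range_succ, Finset.prod_range_succ,
      Finset.prod_range_succ, Nat.factorial_succ]
    have q3 : ∏ i ∈ Finset.range l, ((d : ℝ) + 1 + (i : ℝ)) ≠ 0 := by positivity
    push_cast
    field_simp

end FermiAux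

/-- for real `k > -d/2` the `2k`-th moment converges and
`(1/N₀)∫ ‖x‖^{2k} ρ^{M,d}(x) dx
  = (Γ(d/2+k)/Γ(d/2)) Σ_{l=0}^M ((-k)_l (-M)_l / (l! (d+1)_l)) 2^l`,
i.e. it equals `(Γ(d/2+k)/Γ(d/2)) ₂F₁(-k,-M;d+1;2)`. -/
theorem fermi_moment_hypergeometric (d M : ℕ) (hd : 1 ≤ d) (k : ℝ) (hk : -(d : ℝ) / 2 < k) :
    Integrable (fun x : EuclideanSpace ℝ (Fin d) => ‖x‖ ^ (2 * k) * fermiDensity d M x) ∧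
      (1 / (Nat.choose (M + d) d : ℝ)) *
          ∫ x : EuclideanSpace ℝ (Fin d), ‖x‖ ^ (2 * k) * fermiDensity d M x =
        (Real.Gamma ((d : ℝ) / 2 + k) / Real.Gamma ((d : ℝ) / 2)) *
          ∑ l ∈ Finset.range (M + 1),
            ((∏ i ∈ Finset.range l, (-k + (i : ℝ))) *
                (∏ i ∈ Finset.range l, (-(M : ℝ) + (i : ℝ))) /
              ((Nat.factorial l : ℝ) * ∏ i ∈ Finset.range l, ((d : ℝ) + 1 + (i : ℝ)))) *
                2 ^ l := by
  have h := FermiAux.moment d hd M k hk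
  have e : (fun x : EuclideanSpace ℝ (Fin d) => ‖x‖ ^ (2 * k) * fermiDensity d M x) =
    fun x => (√π ^ d)⁻¹ * (‖x‖ ^ (2 * k) *
      (PowerSeries.coeff M (FermiAux.rs (fun j => x j)) * Real.exp (-‖x‖ ^ 2))) := by
    funext x
    rw [FermiAux.density_eq]; ring
  have hp : √π ^ d ≠ 0 := by positivity
  rw [e]
  refine ⟨h.1.const_mul _, ?_⟩
  rw [integral_const_mul, h.2, ← FermiAux.cc_final, FermiAux.KK]
  field_simp
end

section
/- For every integer d ≥ 1 and all nonnegative integers k and M, the normalised radial moments obey the reflection formula (1/Γ(d/2 + k)) m_{2k}^{N_0(M),d} = (1/Γ(d/2 + M)) m_{2M}^{N_0(k),d}, where N_0(M) = C(M+d, d) and m_{2k}^{N_0(M),d} denotes the normalised 2k-th radial moment of the density with shell label M. -/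
open MeasureTheory Real

section Helpers
open Polynomial

noncomputable def hpol : ℕ → ℝ[X]
  | 0 => 1
  | 1 => 2 * X
  | (n + 2) => 2 * X * hpol (n + 1) - 2 * ((n : ℝ[X]) + 1) * hpol n

lemma hpol_eval (n : ℕ) (x : ℝ) : (hpol n).eval x = hermiteH n x := by
  induction n using Nat.twoStepInduction with
  | zero => simp [hpol, hermiteH]
  | one => simp [hpol, hermiteH]
  | more n h1 h2 => simp [hpol, hermiteH, h1, h2]

lemma hpol_der (n : ℕ) : derivative (hpol (n + 1)) = 2 * ((n : ℝ[X]) + 1) * hpol n := by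
  induction n using Nat.twoStepInduction with
  | zero => simp [hpol]
  | one => simp [hpol]; ring
  | more n h1 h2 =>
    rw [hpol]
    simp only [derivative_sub, derivative_mul, h1, h2, derivative_add, derivative_natCast,
      derivative_X, derivative_one, derivative_ofNat]
    rw [show hpol (n + 2) = 2 * X * hpol (n + 1) - 2 * ((n : ℝ[X]) + 1) * hpol n from rfl]
    push_cast
    ring

lemma hpol_succ (n : ℕ) : hpol (n + 1) = 2 * X * hpol n - derivative (hpol n) := by
  cases n with
  | zero => simp [hpol]
  | succ n => rw [hpol_der]; rfl

lemma hpol_ode (n : ℕ) : derivative (derivative (hpol n)) =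
    2 * X * derivative (hpol n) - 2 * (n : ℝ[X]) * hpol n := by
  have h := hpol_der n
  rw [hpol_succ] at h
  simp only [derivative_sub, derivative_mul, derivative_X, derivative_ofNat] at h
  linear_combination -h

lemma int_mono (n : ℕ) : Integrable (fun x : ℝ => x ^ n * Real.exp (-x ^ 2)) := by
  have := integrable_rpow_mul_exp_neg_mul_sq (b := 1) one_pos (s := n) (by
    have : (0:ℝ) ≤ n := n.cast_nonneg
    linarith)
  simpa using this

lemma int_pol (p : ℝ[X]) : Integrable (fun x : ℝ => p.eval x * Real.exp (-x ^ 2)) := by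
  induction p using Polynomial.induction_on' with
  | add p q hp hq =>
    refine (hp.add hq).congr (Filter.Eventually.of_forall fun x => ?_)
    simp [add_mul]
  | monomial n a => simpa [mul_assoc] using (int_mono n).const_mul a

noncomputable def gE : ℝ[X] →ₗ[ℝ] ℝ where
  toFun p := ∫ x : ℝ, p.eval x * Real.exp (-x ^ 2)
  map_add' p q := by
    rw [← integral_add (int_pol p) (int_pol q)]
    simp [add_mul]
  map_smul' c p := by
    simp [mul_assoc, integral_const_mul]

lemma gE_der (p : ℝ[X]) : gE (derivative p - 2 * X * p) = 0 := by
  refine integral_eq_zero_of_hasDerivAt_of_integrable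
    (f := fun x : ℝ => p.eval x * Real.exp (-x ^ 2)) (fun x => ?_) (int_pol _) (int_pol _)
  have h := (p.hasDerivAt x).mul ((hasDerivAt_pow 2 x).neg.exp)
  refine h.congr_deriv ?_
  simp only [eval_sub, eval_mul, eval_ofNat, eval_X, Pi.neg_apply]
  push_cast
  ring

lemma gE_norm (l : ℕ) : gE (hpol l ^ 2) = 2 ^ l * (Nat.factorial l) * Real.sqrt π := by
  induction l with
  | zero =>
    have := integral_gaussian 1
    simpa [hpol, gE] using this
  | succ l ih =>
    have h := gE_der (hpol l * hpol (l + 1))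
    have e : derivative (hpol l * hpol (l + 1)) - 2 * X * (hpol l * hpol (l + 1))
        = (2 * ((l : ℝ) + 1)) • hpol l ^ 2 - hpol (l + 1) ^ 2 := by
      rw [derivative_mul, hpol_der, smul_eq_C_mul]
      simp only [C_mul, C_add, C_1, C_ofNat, C_eq_natCast, map_natCast]
      linear_combination (hpol (l + 1)) * (hpol_succ l)
    rw [e, map_sub, map_smul, ih] at h
    rw [← sub_eq_zero.1 h, Nat.factorial_succ]
    push_cast
    simp
    ring

noncomputable def mJ (l k : ℕ) : ℝ := gE (X ^ (2 * k) * hpol l ^ 2)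

lemma mJ_one (l : ℕ) : 2 * mJ l 1 = (2 * l + 1) * mJ l 0 := by
  have h := gE_der (X * (2 * (derivative (hpol l)) ^ 2 - 4 * X * hpol l * derivative (hpol l)
    + (4 * X ^ 2 - 4 * (l : ℝ[X]) - 2) * hpol l ^ 2)
    - (2 * hpol l * derivative (hpol l) - 2 * X * hpol l ^ 2)
    - 4 * (X ^ 2 - (2 * (l : ℝ[X]) + 1)) * X * hpol l ^ 2)
  have e : ∀ p q : ℝ[X], p = ((-8 : ℝ)) • (X ^ (2 * 1) * hpol l ^ 2)
      + (4 * (2 * (l : ℝ) + 1)) • (X ^ (2 * 0) * hpol l ^ 2) → gE p = 0 →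
        2 * mJ l 1 = (2 * l + 1) * mJ l 0 := by
    intro p q h1 h2
    rw [h1, map_add, map_smul, map_smul] at h2
    simp only [mJ, smul_eq_mul] at h2 ⊢
    linarith
  refine e _ 0 ?_ h
  simp only [derivative_sub, derivative_mul, derivative_add, derivative_pow, derivative_X,
    derivative_ofNat, derivative_natCast, derivative_one, hpol_ode, smul_eq_C_mul, C_mul, C_add,
    C_neg, C_1, C_ofNat, C_eq_natCast, map_natCast, Nat.cast_ofNat, map_ofNat]
  ring

lemma mJ_rec (l k : ℕ) : 8 * (k + 2) * mJ l (k + 2) = 4 * (2 * k + 3) * (2 * l + 1) * mJ l (k + 1)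
    + (2 * k + 3) * (2 * k + 2) * (2 * k + 1) * mJ l k := by
  have h := gE_der (X ^ (2 * k + 3) *
    (2 * (derivative (hpol l)) ^ 2 - 4 * X * hpol l * derivative (hpol l)
    + (4 * X ^ 2 - 4 * (l : ℝ[X]) - 2) * hpol l ^ 2)
    - (2 * (k : ℝ[X]) + 3) * X ^ (2 * k + 2) *
      (2 * hpol l * derivative (hpol l) - 2 * X * hpol l ^ 2)
    + (2 * (k : ℝ[X]) + 3) * (2 * (k : ℝ[X]) + 2) * X ^ (2 * k + 1) * hpol l ^ 2
    - 4 * (X ^ 2 - (2 * (l : ℝ[X]) + 1)) * X ^ (2 * k + 3) * hpol l ^ 2)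
  have e : ∀ p q : ℝ[X], p = (-(8 * ((k : ℝ) + 2))) • (X ^ (2 * (k + 2)) * hpol l ^ 2)
      + (4 * (2 * (k : ℝ) + 3) * (2 * (l : ℝ) + 1)) • (X ^ (2 * (k + 1)) * hpol l ^ 2)
      + ((2 * (k : ℝ) + 3) * (2 * k + 2) * (2 * k + 1)) • (X ^ (2 * k) * hpol l ^ 2)
       → gE p = 0 → 8 * (k + 2) * mJ l (k + 2) = 4 * (2 * k + 3) * (2 * l + 1) * mJ l (k + 1)
    + (2 * k + 3) * (2 * k + 2) * (2 * k + 1) * mJ l k := by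
    intro p q h1 h2
    rw [h1, map_add, map_add, map_smul, map_smul, map_smul] at h2
    simp only [mJ, smul_eq_mul] at h2 ⊢
    linarith
  refine e _ 0 ?_ h
  simp only [derivative_sub, derivative_mul, derivative_add, derivative_pow, derivative_X,
    derivative_ofNat, derivative_natCast, derivative_one, hpol_ode, smul_eq_C_mul, C_mul, C_add,
    C_neg, C_1, C_ofNat, C_eq_natCast, map_natCast, Nat.cast_ofNat, map_ofNat, Nat.add_sub_cancel,
    Nat.cast_add, Nat.cast_mul, Nat.cast_one, show 2 * k + 3 - 1 = 2 * k + 2 from rfl,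
    show 2 * k + 2 - 1 = 2 * k + 1 from rfl]
  ring

end Helpers

section Helpers2
open PowerSeries

noncomputable def gg : ℝ⟦X⟧ := PowerSeries.mk 1

lemma gg_mul : gg * (1 - X) = 1 := mk_one_mul_one_sub_eq_one ℝ

lemma gg_der : d⁄dX ℝ gg = gg ^ 2 := by
  have h := congrArg (d⁄dX ℝ) gg_mul
  rw [Derivation.leibniz, map_sub, derivative_X, derivative_one] at h
  simp only [smul_eq_mul] at h
  linear_combination gg * h - (d⁄dX ℝ gg) * gg_mul

lemma gg_pow_der (n : ℕ) : d⁄dX ℝ (gg ^ n) = n * gg ^ (n + 1) := by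
  rw [derivative_pow, gg_der]
  cases n with
  | zero => simp
  | succ n => simp; ring

lemma onex_pow_der (k : ℕ) : d⁄dX ℝ ((1 + X : ℝ⟦X⟧) ^ (k + 1)) = ((k : ℝ⟦X⟧) + 1) * (1 + X) ^ k := by
  rw [derivative_pow, map_add, derivative_X, derivative_one]
  simp

lemma onex_pow_der' (k : ℕ) : (1 + X) * d⁄dX ℝ ((1 + X : ℝ⟦X⟧) ^ k) = (k : ℝ⟦X⟧) * (1 + X) ^ k := by
  cases k with
  | zero => simp
  | succ k => rw [onex_pow_der]; push_cast; ring

noncomputable def PP (d k : ℕ) : ℝ⟦X⟧ := (1 + X) ^ k * gg ^ (d + 1 + k)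

lemma PP_k0 (d : ℕ) : 2 * (X * d⁄dX ℝ (PP d 0)) + (1 + (d : ℝ⟦X⟧)) * PP d 0
    = (1 + (d : ℝ⟦X⟧)) * PP d 1 := by
  simp only [PP, pow_zero, one_mul, gg_pow_der]
  push_cast
  linear_combination (-(1 + (d : ℝ⟦X⟧)) * gg ^ (d + 1)) * gg_mul

lemma PP_k (d k : ℕ) : 2 * (X * d⁄dX ℝ (PP d (k + 1))) + (1 + (d : ℝ⟦X⟧)) * PP d (k + 1)
    = ((k : ℝ⟦X⟧) + 2 + (d : ℝ⟦X⟧)) * PP d (k + 2) - ((k : ℝ⟦X⟧) + 1) * PP d k := by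
  simp only [PP, Derivation.leibniz, smul_eq_mul, gg_pow_der, onex_pow_der]
  push_cast
  linear_combination (-(((d : ℝ⟦X⟧) + (k : ℝ⟦X⟧) + 2) * (1 + X) * gg + ((k : ℝ⟦X⟧) + 1)) *
    ((1 + X) ^ k * gg ^ (d + 1 + k))) * gg_mul

lemma PP_M (d k : ℕ) : d⁄dX ℝ (PP d k) - X * (X * d⁄dX ℝ (PP d k)) =
    (2 * (k : ℝ⟦X⟧) + 1 + (d : ℝ⟦X⟧)) * PP d k + (1 + (d : ℝ⟦X⟧)) * (X * PP d k) := by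
  have e : d⁄dX ℝ (PP d k) = (1 + X) ^ k * (((d : ℝ⟦X⟧) + 1 + (k : ℝ⟦X⟧)) * gg ^ (d + 1 + k + 1)) +
      gg ^ (d + 1 + k) * d⁄dX ℝ ((1 + X : ℝ⟦X⟧) ^ k) := by
    simp only [PP, Derivation.leibniz, smul_eq_mul, gg_pow_der]
    push_cast
    ring
  rw [e, PP]
  linear_combination (gg ^ (d + 1 + k) * (1 - X)) * onex_pow_der' k +
    (((d : ℝ⟦X⟧) + 1 + (k : ℝ⟦X⟧)) * (1 + X) * ((1 + X) ^ k * gg ^ (d + 1 + k))) * gg_mul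

lemma coeff_X_der (p : ℝ⟦X⟧) (n : ℕ) : coeff n (X * d⁄dX ℝ p) = n * coeff n p := by
  cases n with
  | zero => simp
  | succ n => rw [coeff_succ_X_mul, coeff_derivative]; push_cast; ring

lemma coeff_const_mul (c : ℝ) (a p : ℝ⟦X⟧) (h : a = C c) (n : ℕ) :
    coeff n (a * p) = c * coeff n p := by
  rw [h, coeff_C_mul]

noncomputable def AA (d k M : ℕ) : ℝ := coeff M (PP d k)

lemma AA_k0 (d M : ℕ) : (1 + (d : ℝ)) * AA d 1 M = (2 * M + 1 + d) * AA d 0 M := by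
  have h := congrArg (coeff M) (PP_k0 d)
  rw [map_add, coeff_const_mul 2 2 _ (by simp [map_ofNat]), coeff_const_mul (1 + d) (1 + (d : ℝ⟦X⟧)) _ (by simp [map_ofNat]),
    coeff_const_mul (1 + d) (1 + (d : ℝ⟦X⟧)) _ (by simp [map_ofNat]), coeff_X_der] at h
  unfold AA
  linarith

lemma AA_k (d k M : ℕ) : ((k : ℝ) + 2 + d) * AA d (k + 2) M =
    (2 * M + 1 + d) * AA d (k + 1) M + (k + 1) * AA d k M := by
  have h := congrArg (coeff M) (PP_k d k)
  rw [map_add, map_sub, coeff_const_mul 2 2 _ (by simp [map_ofNat]), coeff_const_mul (1 + d) (1 + (d : ℝ⟦X⟧)) _ (by simp [map_ofNat]),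
    coeff_const_mul (k + 2 + d) ((k : ℝ⟦X⟧) + 2 + (d : ℝ⟦X⟧)) _ (by simp [map_ofNat]), coeff_const_mul (k + 1) ((k : ℝ⟦X⟧) + 1) _ (by simp [map_ofNat]),
    coeff_X_der] at h
  unfold AA
  linarith

lemma AA_M0 (d k : ℕ) : AA d k 1 = (2 * k + 1 + d) * AA d k 0 := by
  have h := congrArg (coeff 0) (PP_M d k)
  rw [map_add, map_sub, coeff_const_mul (2 * k + 1 + d) (2 * (k : ℝ⟦X⟧) + 1 + (d : ℝ⟦X⟧)) _ (by simp [map_ofNat]),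
    coeff_const_mul (1 + d) (1 + (d : ℝ⟦X⟧)) _ (by simp [map_ofNat]), coeff_derivative, coeff_zero_X_mul,
    coeff_zero_X_mul] at h
  unfold AA
  norm_num at h ⊢
  linarith

lemma AA_M (d k M : ℕ) : ((M : ℝ) + 2) * AA d k (M + 2) =
    (2 * k + 1 + d) * AA d k (M + 1) + (M + 1 + d) * AA d k M := by
  have h := congrArg (coeff (M + 1)) (PP_M d k)
  rw [map_add, map_sub, coeff_const_mul (2 * k + 1 + d) (2 * (k : ℝ⟦X⟧) + 1 + (d : ℝ⟦X⟧)) _ (by simp [map_ofNat]),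
    coeff_const_mul (1 + d) (1 + (d : ℝ⟦X⟧)) _ (by simp [map_ofNat]), coeff_derivative, coeff_succ_X_mul,
    coeff_succ_X_mul, coeff_X_der] at h
  unfold AA
  push_cast at h
  linarith

lemma AA_zero_right (d k : ℕ) : AA d k 0 = 1 := by
  simp [AA, PP, gg]

lemma AA_zero_left (d M : ℕ) : AA d 0 M = (M + d).choose d := by
  simp [AA, PP, gg, mk_one_pow_eq_mk_choose_add, add_comm]

lemma choose_rec (k d : ℕ) : ((k + 1 + d).choose d : ℝ) * (k + 1) = (k + d).choose d * (k + 1 + d) := by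
  have h := Nat.add_one_mul_choose_eq (k + d) k
  have e1 : (k + d).choose k = (k + d).choose d := Nat.choose_symm_add
  have e2 : (k + d + 1).choose (k + 1) = (k + 1 + d).choose d := by
    rw [← Nat.choose_symm_add (a := k + 1) (b := d)]; congr 1; ring
  rw [e1, e2] at h
  have h' : (((k + d + 1) * (k + d).choose d : ℕ) : ℝ) = (((k + 1 + d).choose d * (k + 1) : ℕ) : ℝ) := by
    rw [h]
  push_cast at h'
  linarith

lemma AA_symm (d k M : ℕ) :
    AA d k M * (k + d).choose d = AA d M k * (M + d).choose d := by
  induction k using Nat.twoStepInduction with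
  | zero => rw [AA_zero_left, AA_zero_right]; simp
  | one =>
    rw [AA_M0, AA_zero_right]
    have h := AA_k0 d M
    rw [AA_zero_left] at h
    have : ((1 + d).choose d : ℝ) = 1 + d := by
      rw [add_comm 1 d, Nat.choose_succ_self_right]; push_cast; ring
    rw [this]
    linarith
  | more k h1 h2 =>
    have c1 := choose_rec k d
    have c2 := choose_rec (k + 1) d
    have r1 := AA_k d k M
    have r2 := AA_M d M k
    rw [show k + 1 + 1 + d = k + 2 + d from rfl] at c2
    push_cast at c2
    have hk : ((k : ℝ) + 2) ≠ 0 := by positivity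
    apply mul_left_cancel₀ hk
    linear_combination AA d (k + 2) M * c2 + ((k + 1 + d).choose d : ℝ) * r1 + AA d k M * c1
      - ((M + d).choose d : ℝ) * r2 + (2 * M + 1 + d) * h2 + (k + 1 + d) * h1

noncomputable def rr : ℕ → ℝ
  | 0 => 1
  | (n + 1) => (n + 1 / 2) * rr n

lemma mJ_eq (l k : ℕ) : mJ l k = rr k * AA 0 k l * (2 ^ l * (Nat.factorial l) * Real.sqrt π) := by
  have h0 : mJ l 0 = (2 ^ l * (Nat.factorial l) * Real.sqrt π) := by
    rw [← gE_norm, mJ]; simp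
  induction k using Nat.twoStepInduction with
  | zero => rw [h0, AA_zero_left]; simp [rr]
  | one =>
    have h := mJ_one l
    have h2 := AA_k0 0 l
    rw [AA_zero_left] at h2
    rw [h0] at h
    simp only [rr]
    norm_num at h2 ⊢
    rw [h2]
    linarith
  | more k h1 h2 =>
    have h := mJ_rec l k
    have r := AA_k 0 k l
    have hk : (8 * ((k : ℝ) + 2)) ≠ 0 := by positivity
    apply mul_left_cancel₀ hk
    rw [h, h1, h2]
    simp only [rr]
    push_cast at r ⊢
    generalize (2 ^ l * (Nat.factorial l) * Real.sqrt π : ℝ) = c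
    linear_combination (-8 * (k + 1 + 1 / 2) * (k + 1 / 2) * rr k * c) * r

noncomputable def RR : ℝ⟦X⟧ := PowerSeries.mk fun n => rr n / n.factorial

lemma RR_der : d⁄dX ℝ RR - X * d⁄dX ℝ RR = C (1 / 2) * RR := by
  ext n
  rw [map_sub, coeff_X_der, coeff_derivative, coeff_C_mul]
  simp only [RR, coeff_mk, rr, Nat.factorial_succ]
  push_cast
  have : (n.factorial : ℝ) ≠ 0 := by positivity
  have : (n : ℝ) + 1 ≠ 0 := by positivity
  field_simp
  ring

lemma RR_pow_der (d : ℕ) : d⁄dX ℝ (RR ^ d) - X * d⁄dX ℝ (RR ^ d) = C ((d : ℝ) / 2) * RR ^ d := by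
  induction d with
  | zero => simp
  | succ d ih =>
    rw [pow_succ, Derivation.leibniz]
    simp only [smul_eq_mul]
    have : C (((d + 1 : ℕ) : ℝ) / 2) = C ((d : ℝ) / 2) + C (1 / 2) := by
      rw [← map_add]; congr 1; push_cast; ring
    rw [this]
    linear_combination RR ^ d * RR_der + RR * ih

lemma RR_gamma (d : ℕ) (hd : 1 ≤ d) (k : ℕ) :
    k.factorial * coeff k (RR ^ d) * Real.Gamma ((d : ℝ) / 2) = Real.Gamma ((d : ℝ) / 2 + k) := by
  have hd' : (0 : ℝ) < d := by exact_mod_cast hd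
  induction k with
  | zero => simp [RR, rr]
  | succ k ih =>
    have h := congrArg (coeff k) (RR_pow_der d)
    rw [map_sub, coeff_X_der, coeff_derivative, coeff_C_mul] at h
    push_cast
    rw [← add_assoc, Real.Gamma_add_one (by positivity), ← ih, Nat.factorial_succ]
    push_cast
    linear_combination (k.factorial * Real.Gamma ((d : ℝ) / 2)) * h

lemma coeff_prod_pi (d m : ℕ) (f : Fin d → ℝ⟦X⟧) :
    coeff m (∏ j, f j) = ∑ l ∈ Finset.piAntidiag Finset.univ m, ∏ j, coeff (l j) (f j) := by
  rw [coeff_prod]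
  refine Finset.sum_equiv Finsupp.equivFunOnFinite ?_ ?_
  · intro i; simp
  · intro i _; simp

lemma sum_shell (d M : ℕ) (F : (Fin d → ℕ) → ℝ) :
    ∑ l ∈ Finset.filter (fun l => ∑ j, l j ≤ M)
      (Fintype.piFinset fun _ : Fin d => Finset.range (M + 1)), F l
    = ∑ m ∈ Finset.range (M + 1), ∑ l ∈ Finset.piAntidiag Finset.univ m, F l := by
  rw [← Finset.sum_fiberwise_of_maps_to (t := Finset.range (M + 1)) (g := fun l => ∑ j, l j)]
  · refine Finset.sum_congr rfl fun m hm => Finset.sum_congr ?_ fun _ _ => rfl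
    ext l
    simp only [Finset.mem_filter, Fintype.mem_piFinset, Finset.mem_range, Finset.mem_piAntidiag,
      Finset.mem_univ] at hm ⊢
    change _ ∧ Finset.univ.sum l = m ↔ _
    constructor
    · rintro ⟨_, h⟩; exact ⟨h, by simp⟩
    · rintro ⟨h, _⟩
      have h' : ∑ j, l j = m := h
      refine ⟨⟨fun j => ?_, by rw [h']; omega⟩, h⟩
      have := Finset.single_le_sum (f := l) (fun i _ => Nat.zero_le _) (Finset.mem_univ j)
      rw [h'] at this
      omega
  · intro l hl
    simp only [Finset.mem_filter, Finset.mem_range] at hl ⊢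
    omega

lemma sum_shell_AA (d M k : ℕ) (n : Fin d → ℕ) (hn : ∑ j, n j = k) :
    ∑ l ∈ Finset.filter (fun l => ∑ j, l j ≤ M)
      (Fintype.piFinset fun _ : Fin d => Finset.range (M + 1)), ∏ j, AA 0 (n j) (l j)
    = AA d k M := by
  rw [sum_shell]
  simp only [AA, ← coeff_prod_pi]
  have e : PP d k = (∏ j, PP 0 (n j)) * gg := by
    simp only [PP, Finset.prod_mul_distrib, Finset.prod_pow_eq_pow_sum, Finset.sum_add_distrib, hn]
    simp
    ring
  rw [e, coeff_mul, Finset.Nat.sum_antidiagonal_eq_sum_range_succ_mk]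
  simp [gg]

lemma psi_sq (l n : ℕ) (x : ℝ) : (x ^ 2) ^ n * ψho l x ^ 2 =
    (2 ^ l * (Nat.factorial l) * Real.sqrt π)⁻¹ *
      ((Polynomial.X ^ (2 * n) * hpol l ^ 2 : Polynomial ℝ).eval x * Real.exp (-x ^ 2)) := by
  have e : Real.exp (-x ^ 2) = Real.exp (-x ^ 2 / 2) ^ 2 := by
    rw [← Real.exp_nat_mul]; congr 1; push_cast; ring
  rw [ψho, mul_pow, mul_pow, inv_pow, Real.sq_sqrt (by positivity), e]
  simp only [Polynomial.eval_mul, Polynomial.eval_pow, Polynomial.eval_X, hpol_eval]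
  ring

lemma psi_int (l n : ℕ) : Integrable (fun x : ℝ => (x ^ 2) ^ n * ψho l x ^ 2) := by
  simp only [psi_sq]
  exact (int_pol _).const_mul _

lemma psi_moment (l n : ℕ) : ∫ x : ℝ, (x ^ 2) ^ n * ψho l x ^ 2 = rr n * AA 0 n l := by
  simp only [psi_sq]
  rw [integral_const_mul]
  have h := mJ_eq l n
  have e : mJ l n = ∫ x : ℝ, (Polynomial.X ^ (2 * n) * hpol l ^ 2 : Polynomial ℝ).eval x
    * Real.exp (-x ^ 2) := rfl
  rw [← e, h]
  have : (2 ^ l * (Nat.factorial l) * Real.sqrt π) ≠ 0 := by positivity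
  field_simp

lemma moment_eq (d k M : ℕ) :
    ∫ x : EuclideanSpace ℝ (Fin d), ‖x‖ ^ (2 * k) * fermiDensity d M x =
      k.factorial * coeff k (RR ^ d) * AA d k M := by
  rw [← (PiLp.volume_preserving_toLp (Fin d)).integral_comp
    (MeasurableEquiv.toLp 2 _).measurableEmbedding]
  have e : ∀ x : Fin d → ℝ, ‖WithLp.toLp 2 x‖ ^ (2 * k) * fermiDensity d M (WithLp.toLp 2 x) =
      ∑ n ∈ Finset.piAntidiag Finset.univ k, ∑ l ∈ Finset.filter (fun l => ∑ j, l j ≤ M)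
      (Fintype.piFinset fun _ : Fin d => Finset.range (M + 1)),
        (Nat.multinomial Finset.univ n : ℝ) * ∏ j, ((x j ^ 2) ^ n j * ψho (l j) (x j) ^ 2) := by
    intro x
    rw [pow_mul, EuclideanSpace.norm_sq_eq]
    simp only [Real.norm_eq_abs, sq_abs]
    rw [Finset.sum_pow_eq_sum_piAntidiag, fermiDensity, Finset.sum_mul_sum]
    simp only [Finset.prod_mul_distrib, mul_assoc]
  simp only [e]
  have hi : ∀ (n l : Fin d → ℕ), Integrable (fun x : Fin d → ℝ =>
      (Nat.multinomial Finset.univ n : ℝ) * ∏ j, ((x j ^ 2) ^ n j * ψho (l j) (x j) ^ 2)) :=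
    fun n l => (Integrable.fintype_prod (f := fun j (y : ℝ) => (y ^ 2) ^ n j * ψho (l j) y ^ 2)
      fun j => psi_int _ _).const_mul _
  rw [integral_finsetSum _ fun n _ => integrable_finsetSum _ fun l _ => hi n l]
  rw [← Fin.prod_const d RR, coeff_prod_pi, Finset.mul_sum, Finset.sum_mul]
  refine Finset.sum_congr rfl fun n hn => ?_
  have hn' : ∑ j, n j = k := by simpa using hn
  rw [integral_finsetSum _ fun l _ => hi n l, ← sum_shell_AA d M k n hn', Finset.mul_sum]
  refine Finset.sum_congr rfl fun l _ => ?_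
  rw [integral_const_mul, integral_fintype_prod_volume_eq_prod
    (fun j (y : ℝ) => (y ^ 2) ^ n j * ψho (l j) y ^ 2)]
  simp only [psi_moment, Finset.prod_mul_distrib]
  rw [← mul_assoc]
  congr 1
  simp only [RR, coeff_mk, Finset.prod_div_distrib]
  have hm := Nat.multinomial_spec Finset.univ n
  rw [hn'] at hm
  rw [← hm]
  push_cast
  have : (∏ j, ((n j).factorial : ℝ)) ≠ 0 := Finset.prod_ne_zero_iff.2 fun j _ => by positivity
  field_simp

end Helpers2

/-- the reflection formula
`(1/Γ(d/2+k)) m_{2k}^{N₀(M),d} = (1/Γ(d/2+M)) m_{2M}^{N₀(k),d}`. -/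
theorem fermi_moment_reflection (d : ℕ) (hd : 1 ≤ d) (k M : ℕ) :
    (1 / Real.Gamma ((d : ℝ) / 2 + (k : ℝ))) *
        ((1 / (Nat.choose (M + d) d : ℝ)) *
          ∫ x : EuclideanSpace ℝ (Fin d), ‖x‖ ^ (2 * k) * fermiDensity d M x) =
      (1 / Real.Gamma ((d : ℝ) / 2 + (M : ℝ))) *
        ((1 / (Nat.choose (k + d) d : ℝ)) *
          ∫ x : EuclideanSpace ℝ (Fin d), ‖x‖ ^ (2 * M) * fermiDensity d k x) := by
  have hd' : (0 : ℝ) < d := by exact_mod_cast hd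
  have hg : Real.Gamma ((d : ℝ) / 2) ≠ 0 := (Real.Gamma_pos_of_pos (by positivity)).ne'
  have key : ∀ a b : ℕ, (1 / Real.Gamma ((d : ℝ) / 2 + (a : ℝ))) *
        ((1 / (Nat.choose (b + d) d : ℝ)) *
          ∫ x : EuclideanSpace ℝ (Fin d), ‖x‖ ^ (2 * a) * fermiDensity d b x) =
      AA d a b / (Nat.choose (b + d) d * Real.Gamma ((d : ℝ) / 2)) := by
    intro a b
    have h := RR_gamma d hd a
    have h1 : Real.Gamma ((d : ℝ) / 2 + a) ≠ 0 := (Real.Gamma_pos_of_pos (by positivity)).ne'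
    have h2 : (Nat.choose (b + d) d : ℝ) ≠ 0 := by
      exact_mod_cast (Nat.choose_pos (Nat.le_add_left d b)).ne'
    rw [moment_eq]
    generalize Real.Gamma ((d : ℝ) / 2 + a) = G at h h1 ⊢
    field_simp
    rw [← h]
    ring
  rw [key, key]
  have h1 : (Nat.choose (M + d) d : ℝ) ≠ 0 := by
    exact_mod_cast (Nat.choose_pos (Nat.le_add_left d M)).ne'
  have h2 : (Nat.choose (k + d) d : ℝ) ≠ 0 := by
    exact_mod_cast (Nat.choose_pos (Nat.le_add_left d k)).ne'
  have h := AA_symm d k M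
  rw [div_eq_div_iff (by positivity) (by positivity)]
  linear_combination Real.Gamma ((d : ℝ) / 2) * h
end

section
/- For every real x > 2, the series Σ_{k=0}^∞ (2^{k+1} k! / (k+2)!) x^{-k-1} converges and equals 1 + (x/2 - 1) · log(1 - 2/x); that is, the generating function of the leading moment coefficients μ^{(2)}_{k,0} = 2^{k+1} k!/(k+2)! of the two-dimensional Fermi gas is G_0(x) = -log(1 - 2/x) + (x/2) log(1 - 2/x) + 1. -/
open MeasureTheory Real

/-- for `x > 2`, `Σ_{k=0}^∞ (2^{k+1} k!/(k+2)!) x^{-k-1}` converges to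
`1 + (x/2 - 1) log(1 - 2/x)`, i.e. `G₀(x) = -log(1-2/x) + (x/2) log(1-2/x) + 1`. -/
theorem stieltjes_transform_G0_2d (x : ℝ) (hx : 2 < x) :
    HasSum (fun k : ℕ =>
        2 ^ (k + 1) * (Nat.factorial k : ℝ) / (Nat.factorial (k + 2) : ℝ) *
          x ^ (-(k : ℤ) - 1))
      (1 + (x / 2 - 1) * Real.log (1 - 2 / x)) := by
  have hx0 : x ≠ 0 := by positivity
  have hy : |2 / x| < 1 := by
    rw [abs_of_pos (by positivity), div_lt_one (by positivity)]
    exact hx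
  have h1 := Real.hasSum_pow_div_log_of_abs_lt_one hy
  have h2 := (hasSum_nat_add_iff' 1).mpr h1
  have h3 := h1.sub (h2.mul_left (x / 2))
  convert h3 using 1
  · rfl
  · funext k
    have e : x ^ (-(k : ℤ) - 1) = (x ^ (k + 1))⁻¹ := by
      rw [show (-(k : ℤ) - 1) = -((k + 1 : ℕ) : ℤ) by push_cast; ring, zpow_neg, zpow_natCast]
    have hk1 : (k : ℝ) + 1 ≠ 0 := by positivity
    have hk2 : (k : ℝ) + 2 ≠ 0 := by positivity
    have hk3 : (k : ℝ) + 1 + 1 ≠ 0 := by positivity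
    have hf : (Nat.factorial k : ℝ) ≠ 0 := by positivity
    rw [e, Nat.factorial_succ, Nat.factorial_succ]
    push_cast
    simp only [div_pow]
    field_simp
    ring
  · generalize Real.log (1 - 2 / x) = L
    simp
    field_simp
    ring
end

section
/- For every real x > 2, the series Σ_{k=0}^∞ μ^{(2)}_{k,1} x^{-k-1}, with μ^{(2)}_{k,1} = (2^{k+1} k!/(k+2)!) · k(k-1)(2k+5)/24, converges and equals -(1/12) ( 3 log(1 - 2/x) - (3x/2) log(1 - 2/x) + 3/(x-2) - 4/(x-2)² - 3 ). -/
open MeasureTheory Real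

/-- for `x > 2`, with `μ^{(2)}_{k,1} = (2^{k+1} k!/(k+2)!) k(k-1)(2k+5)/24`,
`Σ_{k=0}^∞ μ^{(2)}_{k,1} x^{-k-1}
  = -(1/12)(3 log(1-2/x) - (3x/2) log(1-2/x) + 3/(x-2) - 4/(x-2)² - 3)`. -/
theorem stieltjes_transform_G1_2d (x : ℝ) (hx : 2 < x) :
    HasSum (fun k : ℕ =>
        (2 ^ (k + 1) * (Nat.factorial k : ℝ) / (Nat.factorial (k + 2) : ℝ)) *
          ((k : ℝ) * ((k : ℝ) - 1) * (2 * (k : ℝ) + 5) / 24) * x ^ (-(k : ℤ) - 1))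
      (-(1 / 12) * (3 * Real.log (1 - 2 / x) - (3 * x / 2) * Real.log (1 - 2 / x) +
        3 / (x - 2) - 4 / (x - 2) ^ 2 - 3)) := by
  have hx0 : x ≠ 0 := by linarith
  have hx2 : x - 2 ≠ 0 := by linarith
  obtain ⟨r, hr⟩ : ∃ r : ℝ, r = 2 / x := ⟨_, rfl⟩
  have hr0 : 0 < r := by rw [hr]; exact div_pos two_pos (by linarith)
  have hr1 : r < 1 := by rw [hr, div_lt_one (by linarith)]; exact hx
  have habs : |r| < 1 := by rw [abs_of_pos hr0]; exact hr1
  have h1 := hasSum_pow_div_log_of_abs_lt_one habs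
  have h2 := (hasSum_nat_add_iff' 1).mpr h1
  have h3 := (hasSum_geometric_of_abs_lt_one habs).mul_left (-(3 * r / 24))
  have h4 := (hasSum_coe_mul_geometric_of_norm_lt_one (r := r) habs).mul_left (2 * r / 24)
  have h5 := ((h4.add h3).add (h1.mul_left (6 / 24))).sub (h2.mul_left (6 / (24 * r)))
  convert! h5 using 1
  · funext k
    have e : x ^ (-(k : ℤ) - 1) = (r / 2) ^ (k + 1) := by
      have : r / 2 = x⁻¹ := by rw [hr]; field_simp
      rw [this, inv_pow, ← zpow_natCast, ← zpow_neg]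
      congr 1
      push_cast
      ring
    have hk1 : (k : ℝ) + 1 ≠ 0 := by positivity
    have hk2 : (k : ℝ) + 2 ≠ 0 := by positivity
    have hk3 : (k : ℝ) + 1 + 1 ≠ 0 := by positivity
    have hf : (Nat.factorial k : ℝ) ≠ 0 := by positivity
    rw [e, div_pow, Nat.factorial_succ, Nat.factorial_succ]
    push_cast
    have hr' := hr0.ne'
    field_simp
    ring
  · rw [← hr]
    have hxr : x = 2 / r := by rw [hr]; field_simp
    have h1r : 1 - r ≠ 0 := by linarith
    have e2 : x - 2 = 2 * (1 - r) / r := by rw [hxr]; field_simp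
    have hr' := hr0.ne'
    rw [e2, hxr]
    simp only [Finset.sum_range_one]
    generalize Real.log (1 - r) = L
    push_cast
    field_simp
    ring
end
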